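/- The set Φ is locally linearly independent on Ω: for every open set O ⊆ ℝ² with O ∩ Ω ≠ ∅, the functions of Φ that do not vanish identically on O ∩ Ω are linearly independent as functions on O ∩ Ω. -/

import Mathlib

noncomputable section
open Set

namespace TwoPatch



/-- Cox–de Boor recursion for B-splines over the knot sequence `t`.  Degree-`0`
B-splines are the characteristic functions of `[t i, t (i+1))`, closed at the
right endpoint when `t (i+1) = 1` (the right end of the parametric domain),
and the usual convention `0/0 = 0` is used in the recursion. -/
def coxDeBoor (t : ℕ → ℝ) : ℕ → ℕ → ℝ → ℝ
  | 0, i, x =>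
      if (t i ≤ x ∧ x < t (i + 1)) ∨ (t i < t (i + 1) ∧ t (i + 1) = 1 ∧ x = 1) then 1 else 0
  | (d + 1), i, x =>
      (if t (i + d + 1) = t i then 0 else (x - t i) / (t (i + d + 1) - t i)) *
          coxDeBoor t d i x +
        (if t (i + d + 2) = t (i + 1) then 0
          else (t (i + d + 2) - x) / (t (i + d + 2) - t (i + 1))) *
          coxDeBoor t d (i + 1) x

/-- The open knot vector on `[0,1]` of degree `dg`:  `0` and `1` appear with
multiplicity `dg + 1` and each of the `k` inner breakpoints `τ 0 < … < τ (k-1)`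
appears with multiplicity `m`. -/
def openKnots (dg m k : ℕ) (τ : ℕ → ℝ) (j : ℕ) : ℝ :=
  if j ≤ dg then 0 else if dg + k * m < j then 1 else τ ((j - (dg + 1)) / m)

/-- The `i`-th B-spline of degree `dg`, inner-knot multiplicity `m`, over the
breakpoints `τ 0, …, τ (k-1)`. -/
def Bspl (dg m k : ℕ) (τ : ℕ → ℝ) (i : ℕ) : ℝ → ℝ :=
  coxDeBoor (openKnots dg m k τ) dg i

/-- The dimension of the corresponding spline space. -/
def sdim (dg m k : ℕ) : ℕ := dg + 1 + k * m

/-- The univariate spline space, as a subspace of `ℝ → ℝ`. -/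
def splineSpace (dg m k : ℕ) (τ : ℕ → ℝ) : Submodule ℝ (ℝ → ℝ) :=
  Submodule.span ℝ (Bspl dg m k τ '' Set.Iio (sdim dg m k))

/-- The tensor-product spline space `span {g(ξ₁)h(ξ₂) : g, h ∈ S}`. -/
def tensorSpace (dg m k : ℕ) (τ : ℕ → ℝ) : Submodule ℝ (ℝ × ℝ → ℝ) :=
  Submodule.span ℝ
    {f | ∃ g ∈ splineSpace dg m k τ, ∃ h ∈ splineSpace dg m k τ,
        f = fun q : ℝ × ℝ => g q.1 * h q.2}

/-- The parametric interval `[0,1]`. -/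
def I01 : Set ℝ := Set.Icc 0 1

/-- The parametric square `[0,1]²`. -/
def sq : Set (ℝ × ℝ) := Set.Icc (0, 0) (1, 1)

/-- Derivative of a univariate function within `[0,1]` (one-sided at the endpoints). -/
def d01 (g : ℝ → ℝ) (x : ℝ) : ℝ := derivWithin g I01 x

/-- First partial derivative (within `[0,1]` in the first variable). -/
def pd1 (f : ℝ × ℝ → ℝ) (q : ℝ × ℝ) : ℝ := derivWithin (fun s => f (s, q.2)) I01 q.1

/-- Second partial derivative (within `[0,1]` in the second variable). -/
def pd2 (f : ℝ × ℝ → ℝ) (q : ℝ × ℝ) : ℝ := derivWithin (fun s => f (q.1, s)) I01 q.2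

/-- First partial derivative of a map into `ℝ²`. -/
def pd1v (F : ℝ × ℝ → ℝ × ℝ) (q : ℝ × ℝ) : ℝ × ℝ :=
  (pd1 (fun x => (F x).1) q, pd1 (fun x => (F x).2) q)

/-- Second partial derivative of a map into `ℝ²`. -/
def pd2v (F : ℝ × ℝ → ℝ × ℝ) (q : ℝ × ℝ) : ℝ × ℝ :=
  (pd2 (fun x => (F x).1) q, pd2 (fun x => (F x).2) q)

/-- Jacobian determinant. -/
def jacDet (F : ℝ × ℝ → ℝ × ℝ) (q : ℝ × ℝ) : ℝ :=
  pd1 (fun x => (F x).1) q * pd2 (fun x => (F x).2) q -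
    pd1 (fun x => (F x).2) q * pd2 (fun x => (F x).1) q

/-- The Jacobian matrix. -/
def jacMat (F : ℝ × ℝ → ℝ × ℝ) (q : ℝ × ℝ) : Matrix (Fin 2) (Fin 2) ℝ :=
  !![pd1 (fun x => (F x).1) q, pd2 (fun x => (F x).1) q;
     pd1 (fun x => (F x).2) q, pd2 (fun x => (F x).2) q]

/-- Polynomials of degree at most one ("linear functions"). -/
def IsLinearPoly (a : ℝ → ℝ) : Prop := ∃ c₀ c₁ : ℝ, a = fun x => c₀ + c₁ * x

/-- Breakpoints extended by the endpoints `0` and `1`. -/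
def extBpt (k : ℕ) (τ : ℕ → ℝ) (i : ℕ) : ℝ :=
  if i = 0 then 0 else if i ≤ k then τ (i - 1) else 1

/-- One dyadic refinement of the breakpoint set `τ 0 < … < τ (k-1)`:
the old breakpoints together with the midpoints of the `k+1` intervals
determined by `{0} ∪ T ∪ {1}`. -/
def dyadicOnce (k : ℕ) (τ : ℕ → ℝ) (j : ℕ) : ℝ :=
  if j % 2 = 1 then τ (j / 2) else (extBpt k τ (j / 2) + extBpt k τ (j / 2 + 1)) / 2

/-- Number of breakpoints at level `ℓ`. -/
def levelK (k : ℕ) : ℕ → ℕ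
  | 0 => k
  | ℓ + 1 => 2 * levelK k ℓ + 1

/-- Breakpoints at level `ℓ` (iterated dyadic refinement). -/
def levelτ (k : ℕ) (τ : ℕ → ℝ) : ℕ → ℕ → ℝ
  | 0 => τ
  | ℓ + 1 => dyadicOnce (levelK k ℓ) (levelτ k τ ℓ)

/-- Pullback of the interior basis functions: `N_i^{p,r}(ξ₁) N_j^{p,r}(ξ₂)`. -/
def fOmega (p r k : ℕ) (τ : ℕ → ℝ) (i j : ℕ) (q : ℝ × ℝ) : ℝ :=
  Bspl p (p - r) k τ i q.1 * Bspl p (p - r) k τ j q.2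

/-- Pullback of the interface basis function `φ_{Γ₀,i}` on the patch with
gluing datum `βS`. -/
def fGamma0 (p r k : ℕ) (τ : ℕ → ℝ) (βS : ℝ → ℝ) (i : ℕ) (q : ℝ × ℝ) : ℝ :=
  Bspl p (p - r - 1) k τ i q.2 *
      (Bspl p (p - r) k τ 0 q.1 + Bspl p (p - r) k τ 1 q.1) +
    βS q.2 * d01 (Bspl p (p - r - 1) k τ i) q.2 * (τ 0 / (p : ℝ)) * Bspl p (p - r) k τ 1 q.1

/-- Pullback of the interface basis function `φ_{Γ₁,i}` on the patch with
gluing datum `αS`. -/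
def fGamma1 (p r k : ℕ) (τ : ℕ → ℝ) (αS : ℝ → ℝ) (i : ℕ) (q : ℝ × ℝ) : ℝ :=
  αS q.2 * Bspl (p - 1) (p - r - 1) k τ i q.2 * Bspl p (p - r) k τ 1 q.1

/-- Support of a function on the domain `Ω`. -/
def suppOn (Ω : Set (ℝ × ℝ)) (φ : ℝ × ℝ → ℝ) : Set (ℝ × ℝ) :=
  closure {x | x ∈ Ω ∧ φ x ≠ 0}

/-- An analysis-suitable `G¹` two-patch geometry, on the spline space of degree
`p`, regularity `r`, with `k` inner breakpoints `τ 0 < … < τ (k-1)`.  The two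
geometry mappings `FL` and `FR` are regular spline parameterizations of the two
patches, and `αL, αR, βL, βR` are the linear gluing data. -/
structure ASG1 where
  p : ℕ
  r : ℕ
  k : ℕ
  τ : ℕ → ℝ
  hp : 3 ≤ p
  hr : 1 ≤ r
  hrp : r ≤ p - 2
  hτpos : ∀ i < k, 0 < τ i
  hτlt : ∀ i < k, τ i < 1
  hτmono : ∀ i, i + 1 < k → τ i < τ (i + 1)
  /-- left geometry mapping -/
  FL : ℝ × ℝ → ℝ × ℝ
  /-- right geometry mapping -/
  FR : ℝ × ℝ → ℝ × ℝ
  hFL1 : (fun q => (FL q).1) ∈ tensorSpace p (p - r) k τ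
  hFL2 : (fun q => (FL q).2) ∈ tensorSpace p (p - r) k τ
  hFR1 : (fun q => (FR q).1) ∈ tensorSpace p (p - r) k τ
  hFR2 : (fun q => (FR q).2) ∈ tensorSpace p (p - r) k τ
  hFLc1 : ContDiffOn ℝ 1 FL sq
  hFRc1 : ContDiffOn ℝ 1 FR sq
  hFLinj : Set.InjOn FL sq
  hFRinj : Set.InjOn FR sq
  hFLjac : ∀ q ∈ sq, jacDet FL q ≠ 0
  hFRjac : ∀ q ∈ sq, jacDet FR q ≠ 0
  /-- the two patches share the interface `ξ₁ = 0` -/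
  hIface : ∀ ξ ∈ I01, FL (0, ξ) = FR (0, ξ)
  /-- the patches intersect exactly in the common interface -/
  hGamma : FL '' sq ∩ FR '' sq = (fun ξ : ℝ => FL (0, ξ)) '' I01
  /-- gluing data -/
  αL : ℝ → ℝ
  αR : ℝ → ℝ
  βL : ℝ → ℝ
  βR : ℝ → ℝ
  hαLlin : IsLinearPoly αL
  hαRlin : IsLinearPoly αR
  hβLlin : IsLinearPoly βL
  hβRlin : IsLinearPoly βR
  hαneg : ∀ ξ ∈ I01, αL ξ * αR ξ < 0
  /-- the analysis-suitable `G¹` condition -/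
  hG1 : ∀ ξ ∈ I01,
      αR ξ • pd1v FL (0, ξ) - αL ξ • pd1v FR (0, ξ) +
          (αL ξ * βR ξ - αR ξ * βL ξ) • pd2v FL (0, ξ) = 0

/-- The function `β = α^(L) β^(R) − α^(R) β^(L)`. -/
def ASG1.beta (G : ASG1) : ℝ → ℝ := fun ξ => G.αL ξ * G.βR ξ - G.αR ξ * G.βL ξ

/-- The left patch `Ω^(L)`. -/
def ASG1.ΩL (G : ASG1) : Set (ℝ × ℝ) := G.FL '' sq

/-- The right patch `Ω^(R)`. -/
def ASG1.ΩR (G : ASG1) : Set (ℝ × ℝ) := G.FR '' sq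

/-- The two-patch domain `Ω = Ω^(L) ∪ Ω^(R)`. -/
def ASG1.dom (G : ASG1) : Set (ℝ × ℝ) := G.ΩL ∪ G.ΩR

/-- The interface `Γ`. -/
def ASG1.iface (G : ASG1) : Set (ℝ × ℝ) := (fun ξ : ℝ => G.FL (0, ξ)) '' I01

-- The function on `Ω` whose pullbacks to the two patches are `fL` and `fR`
-- (extended by `0` outside `Ω`).
open Classical in
def ASG1.glue (G : ASG1) (fL fR : ℝ × ℝ → ℝ) (x : ℝ × ℝ) : ℝ :=
  if x ∈ G.ΩL then fL (Function.invFunOn G.FL sq x)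
  else if x ∈ G.ΩR then fR (Function.invFunOn G.FR sq x)
  else 0

/-- Indices for the basis `Φ` of the `C¹` space `W`. -/
inductive PhiIdx where
  | inL (i j : ℕ) : PhiIdx
  | inR (i j : ℕ) : PhiIdx
  | g0 (i : ℕ) : PhiIdx
  | g1 (i : ℕ) : PhiIdx

/-- The valid index ranges for the basis `Φ` (for degree `p`, regularity `r`,
`k` inner breakpoints). -/
def PhiIdx.valid (p r k : ℕ) : PhiIdx → Prop
  | .inL i j => 2 ≤ i ∧ i < sdim p (p - r) k ∧ j < sdim p (p - r) k
  | .inR i j => 2 ≤ i ∧ i < sdim p (p - r) k ∧ j < sdim p (p - r) k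
  | .g0 i => i < sdim p (p - r - 1) k
  | .g1 i => i < sdim (p - 1) (p - r - 1) k

/-- The basis functions of the `C¹` space `W`, for breakpoints `τ' 0 < … < τ' (k'-1)`. -/
def ASG1.phiAt (G : ASG1) (k' : ℕ) (τ' : ℕ → ℝ) : PhiIdx → ℝ × ℝ → ℝ
  | .inL i j => G.glue (fOmega G.p G.r k' τ' i j) (fun _ => 0)
  | .inR i j => G.glue (fun _ => 0) (fOmega G.p G.r k' τ' i j)
  | .g0 i => G.glue (fGamma0 G.p G.r k' τ' G.βL i) (fGamma0 G.p G.r k' τ' G.βR i)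
  | .g1 i => G.glue (fGamma1 G.p G.r k' τ' G.αL i) (fGamma1 G.p G.r k' τ' G.αR i)

/-- The level-`ℓ` basis functions. -/
def ASG1.phiLvl (G : ASG1) (ℓ : ℕ) : PhiIdx → ℝ × ℝ → ℝ :=
  G.phiAt (levelK G.k ℓ) (levelτ G.k G.τ ℓ)

/-- The level-`ℓ` basis `Φ^ℓ`, as a set of functions on the two-patch domain. -/
def ASG1.PhiSetLvl (G : ASG1) (ℓ : ℕ) : Set (ℝ × ℝ → ℝ) :=
  G.phiLvl ℓ '' {e | e.valid G.p G.r (levelK G.k ℓ)}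

/-- The basis `Φ` (level `0`). -/
def ASG1.PhiSet (G : ASG1) : Set (ℝ × ℝ → ℝ) := G.PhiSetLvl 0

open Filter Topology

/-- `x` lies in the `μ`-th knot span of `t`: the degree-`0` B-spline with index `μ` is the only
one that does not vanish at `x`. -/
def Cell (t : ℕ → ℝ) (μ : ℕ) (x : ℝ) : Prop :=
  ∀ i, coxDeBoor t 0 i x = if i = μ then 1 else 0

theorem Cell.unique {t : ℕ → ℝ} {μ ν : ℕ} {x : ℝ} (h : Cell t μ x) (h' : Cell t ν x) : μ = ν := by
  have h1 := h μ
  rw [h' μ] at h1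
  by_contra hne
  simp [hne] at h1

theorem Cell.eq_zero {t : ℕ → ℝ} {μ : ℕ} {x : ℝ} (h : Cell t μ x) (d i : ℕ)
    (hi : ¬ (i ≤ μ ∧ μ ≤ i + d)) : coxDeBoor t d i x = 0 := by
  induction d generalizing i with
  | zero =>
    rw [h i, if_neg]
    omega
  | succ d ih =>
    rw [coxDeBoor, ih i (by omega), ih (i + 1) (by omega)]
    simp

/-- The dual polynomial `∏_{j=1}^{d} (y - t (i+j))`. -/
def dualPoly (t : ℕ → ℝ) (d i : ℕ) (y : ℝ) : ℝ := ∏ j ∈ Finset.range d, (y - t (i + j + 1))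

/-- Marsden's identity on a single knot span. -/
theorem Cell.marsden {t : ℕ → ℝ} (ht : Monotone t) {μ : ℕ} {x : ℝ} (h : Cell t μ x)
    (hμ : t μ < t (μ + 1)) (y : ℝ) (d s : ℕ) (hs : s + d = μ) :
    ∑ j ∈ Finset.range (d + 1), dualPoly t d (s + j) y * coxDeBoor t d (s + j) x
      = (y - x) ^ d := by
  induction d generalizing s with
  | zero =>
    have := h s
    simp_all [dualPoly]
  | succ d ih =>
    have ih' := ih (s + 1) (by omega)
    have key : ∀ j, j ≤ d → 0 < t (s + 1 + j + d + 1) - t (s + 1 + j) := fun j hj => by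
      have h1 : t (s + 1 + j) ≤ t μ := ht (by omega)
      have h2 : t (μ + 1) ≤ t (s + 1 + j + d + 1) := ht (by omega)
      linarith
    have expand : ∀ i, coxDeBoor t (d + 1) i x =
        (if t (i + d + 1) = t i then 0 else (x - t i) / (t (i + d + 1) - t i)) *
          coxDeBoor t d i x +
        (if t (i + d + 2) = t (i + 1) then 0
          else (t (i + d + 2) - x) / (t (i + d + 2) - t (i + 1))) *
          coxDeBoor t d (i + 1) x := fun i => rfl
    simp only [expand, mul_add, Finset.sum_add_distrib]
    rw [Finset.sum_range_succ' _ (d + 1), Finset.sum_range_succ _ (d + 1),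
      h.eq_zero d (s + 0) (by omega), h.eq_zero d (s + (d + 1) + 1) (by omega)]
    simp only [mul_zero, add_zero]
    rw [← Finset.sum_add_distrib, pow_succ, ← ih', Finset.sum_mul]
    refine Finset.sum_congr rfl fun j hj => ?_
    have hk := key j (by simpa [Nat.lt_succ_iff] using hj)
    have e1 : s + (j + 1) = s + 1 + j := by omega
    have e2 : s + j + 1 = s + 1 + j := by omega
    have e3 : s + j + d + 2 = s + 1 + j + d + 1 := by omega
    rw [e1, e2, e3, if_neg (by linarith), if_neg (by linarith)]
    have d1 : dualPoly t (d + 1) (s + 1 + j) y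
        = dualPoly t d (s + 1 + j) y * (y - t (s + 1 + j + d + 1)) := by
      simp [dualPoly, Finset.prod_range_succ]
    have d2 : dualPoly t (d + 1) (s + j) y
        = dualPoly t d (s + 1 + j) y * (y - t (s + 1 + j)) := by
      rw [dualPoly, Finset.prod_range_succ', dualPoly]
      congr 1
      · refine Finset.prod_congr rfl fun a _ => ?_
        congr 2
        omega
      · rw [add_zero, e2]
    rw [d1, d2]
    have := hk.ne'
    field_simp
    ring

theorem det_sub_pow_ne_zero {d : ℕ} {x y : Fin (d + 1) → ℝ} (hx : Function.Injective x)
    (hy : Function.Injective y) :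
    (Matrix.of fun a b => (y a - x b) ^ d : Matrix (Fin (d + 1)) (Fin (d + 1)) ℝ).det ≠ 0 := by
  have hfac : (Matrix.of fun a b => (y a - x b) ^ d : Matrix (Fin (d + 1)) (Fin (d + 1)) ℝ)
      = Matrix.vandermonde y * (Matrix.diagonal (fun j : Fin (d + 1) => (d.choose j : ℝ)) *
          (Matrix.vandermonde (fun b => -x b)).transpose.submatrix Fin.revPerm id) := by
    ext a b
    rw [Matrix.mul_apply]
    simp only [Matrix.of_apply, Matrix.diagonal_mul, Matrix.submatrix_apply, Matrix.transpose_apply,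
      Matrix.vandermonde_apply, Fin.revPerm_apply, Fin.val_rev, id]
    rw [sub_eq_add_neg, add_pow, Finset.sum_range]
    refine Finset.sum_congr rfl fun j _ => ?_
    have : d + 1 - (j + 1) = d - (j : ℕ) := by omega
    rw [this]
    ring
  rw [hfac, Matrix.det_mul, Matrix.det_mul, Matrix.det_permute, Matrix.det_transpose,
    Matrix.det_diagonal]
  refine mul_ne_zero (Matrix.det_vandermonde_ne_zero_iff.2 hy) (mul_ne_zero ?_ (mul_ne_zero ?_
    (Matrix.det_vandermonde_ne_zero_iff.2 fun a b hab => hx (neg_injective hab))))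
  · exact Finset.prod_ne_zero_iff.2 fun j _ =>
      Nat.cast_ne_zero.2 (Nat.choose_pos (by omega)).ne'
  · exact_mod_cast (Equiv.Perm.sign _).ne_zero

/-- A functional dual to the B-spline of index `i₀`, built from point evaluations in an infinite
subset `B` of a knot span. -/
theorem exists_dual {t : ℕ → ℝ} (ht : Monotone t) {μ d : ℕ} (hμ : t μ < t (μ + 1)) (hd : d ≤ μ)
    {B : Set ℝ} (hB : B.Infinite) (hcell : ∀ x ∈ B, Cell t μ x) {i₀ : ℕ}
    (hi : i₀ ≤ μ ∧ μ ≤ i₀ + d) :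
    ∃ x w : Fin (d + 1) → ℝ, (∀ b, x b ∈ B) ∧
      ∀ i, ∑ b, w b * coxDeBoor t d i (x b) = if i = i₀ then 1 else 0 := by
  obtain ⟨s, rfl⟩ := Nat.exists_eq_add_of_le' hd
  obtain ⟨j₀, rfl⟩ := Nat.exists_eq_add_of_le (show s ≤ i₀ by omega)
  let x : Fin (d + 1) → ℝ := fun b => hB.natEmbedding B b
  have hxB : ∀ b, x b ∈ B := fun b => (hB.natEmbedding B b).2
  have hxinj : Function.Injective x := fun a b hab =>
    Fin.val_injective ((hB.natEmbedding B).injective (Subtype.ext hab))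
  let y : Fin (d + 1) → ℝ := fun a => (a : ℕ)
  have hyinj : Function.Injective y := fun a b hab => Fin.val_injective (Nat.cast_injective hab)
  let Ψ : Matrix (Fin (d + 1)) (Fin (d + 1)) ℝ := Matrix.of fun a j => dualPoly t d (s + j) (y a)
  let N : Matrix (Fin (d + 1)) (Fin (d + 1)) ℝ := Matrix.of fun j b => coxDeBoor t d (s + j) (x b)
  have hmul : Ψ * N = Matrix.of fun a b => (y a - x b) ^ d := by
    ext a b
    rw [Matrix.mul_apply, Matrix.of_apply, ← (hcell _ (hxB b)).marsden ht hμ (y a) d s rfl,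
      Finset.sum_range]
    rfl
  have hN : IsUnit N.det := by
    refine isUnit_iff_ne_zero.2 fun h0 => det_sub_pow_ne_zero hxinj hyinj ?_
    rw [← hmul, Matrix.det_mul, h0, mul_zero]
  let j₁ : Fin (d + 1) := ⟨j₀, by omega⟩
  let w := N⁻¹.mulVec (Pi.single j₁ 1)
  have hw : N.mulVec w = Pi.single j₁ 1 := by
    rw [Matrix.mulVec_mulVec, Matrix.mul_nonsing_inv _ hN, Matrix.one_mulVec]
  refine ⟨x, w, hxB, fun i => ?_⟩
  by_cases hact : i ≤ s + d ∧ s + d ≤ i + d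
  · obtain ⟨j, rfl⟩ := Nat.exists_eq_add_of_le (show s ≤ i by omega)
    have := congrFun hw ⟨j, by omega⟩
    rw [Pi.single_apply, Matrix.mulVec, dotProduct] at this
    simp only [j₁, Fin.mk.injEq] at this
    simp only [Nat.add_left_cancel_iff, ← this]
    exact Finset.sum_congr rfl fun b _ => mul_comm _ _
  · rw [if_neg (by omega)]
    exact Finset.sum_eq_zero fun b _ => by rw [(hcell _ (hxB b)).eq_zero d i hact, mul_zero]

/-- The points of `ℝ` on the right of `x`, or on its left when `x = 1`. -/
def side (x : ℝ) : Set ℝ := if x = 1 then Iio x else Ioi x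

theorem infinite_of_mem_side {x : ℝ} {B : Set ℝ} (hB : B ∈ 𝓝[side x] x) : B.Infinite := by
  unfold side at hB
  split_ifs at hB
  · obtain ⟨a, ha, h⟩ := (mem_nhdsLT_iff_exists_Ioo_subset).1 hB
    exact (Ioo_infinite ha).mono h
  · obtain ⟨a, ha, h⟩ := (mem_nhdsGT_iff_exists_Ioo_subset).1 hB
    exact (Ioo_infinite ha).mono h

theorem I01_mem_side {x : ℝ} (hx : x ∈ I01) : I01 ∈ 𝓝[side x] x := by
  unfold side
  split_ifs with h
  · subst h
    exact mem_of_superset (Ioo_mem_nhdsLT one_pos) Ioo_subset_Icc_self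
  · exact mem_of_superset (Ioo_mem_nhdsGT (lt_of_le_of_ne hx.2 h))
      fun z hz => ⟨hx.1.trans hz.1.le, hz.2.le⟩

theorem d01_eq_zero {f : ℝ → ℝ} {x : ℝ} (hx : x ∈ I01) (h0 : f x = 0)
    (h : ∀ᶠ z in 𝓝[side x] x, f z = 0) : d01 f x = 0 := by
  by_cases hf : DifferentiableWithinAt ℝ f I01 x
  · have h1 : HasDerivWithinAt f (d01 f x) (side x) x :=
      hf.hasDerivWithinAt.mono_of_mem_nhdsWithin (I01_mem_side hx)
    have h2 : HasDerivWithinAt f 0 (side x) x :=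
      (hasDerivWithinAt_const x (side x) (0 : ℝ)).congr_of_eventuallyEq h h0
    have hu : UniqueDiffWithinAt ℝ (side x) x := by
      unfold side
      split_ifs
      · exact uniqueDiffWithinAt_Iio x
      · exact uniqueDiffWithinAt_Ioi x
    exact hu.eq_deriv _ h1 h2
  · exact derivWithin_zero_of_not_differentiableWithinAt hf

/-- A nondecreasing knot sequence on `[0,1]` starting with `dg + 1` zeros and reaching `1`. -/
structure IsKnots (dg : ℕ) (t : ℕ → ℝ) : Prop where
  mono : Monotone t
  zero : ∀ j ≤ dg, t j = 0
  le_one : ∀ j, t j ≤ 1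
  exists_one : ∃ M, t M = 1

theorem cell_of_mem {t : ℕ → ℝ} (ht : Monotone t) {μ : ℕ} {x : ℝ} (h1 : t μ ≤ x)
    (h2 : x < t (μ + 1)) (hx : x ≠ 1) : Cell t μ x := by
  intro i
  rw [coxDeBoor]
  refine if_congr ⟨?_, ?_⟩ rfl rfl
  · rintro (⟨h3, h4⟩ | ⟨-, -, h⟩)
    · by_contra hne
      rcases lt_or_gt_of_ne hne with h | h
      · have := ht (show i + 1 ≤ μ by omega)
        linarith
      · have := ht (show μ + 1 ≤ i by omega)
        linarith
    · exact absurd h hx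
  · rintro rfl
    exact Or.inl ⟨h1, h2⟩

theorem IsKnots.exists_cell {dg : ℕ} {t : ℕ → ℝ} (ht : IsKnots dg t) {x : ℝ} (hx : x ∈ I01) :
    ∃ μ, t μ < t (μ + 1) ∧ dg ≤ μ ∧ Cell t μ x ∧ ∀ᶠ z in 𝓝[side x] x, Cell t μ z := by
  classical
  obtain ⟨M, hM⟩ := ht.exists_one
  suffices h : ∃ μ, t μ < t (μ + 1) ∧ Cell t μ x ∧ ∀ᶠ z in 𝓝[side x] x, Cell t μ z by
    obtain ⟨μ, h1, h2⟩ := h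
    refine ⟨μ, h1, ?_, h2⟩
    by_contra hlt
    rw [ht.zero μ (by omega), ht.zero (μ + 1) (by omega)] at h1
    exact lt_irrefl _ h1
  have h00 := ht.zero 0 (Nat.zero_le _)
  by_cases hx1 : x = 1
  · subst hx1
    have hP0 : ¬ t 0 = 1 := by norm_num [h00]
    have hex : ∃ n, t n = 1 := ⟨M, hM⟩
    obtain ⟨μ, hμ⟩ : ∃ μ, Nat.find hex = μ + 1 :=
      Nat.exists_eq_succ_of_ne_zero fun h => hP0 (h ▸ Nat.find_spec hex)
    have hspec : t (μ + 1) = 1 := hμ ▸ Nat.find_spec hex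
    have hlt : t μ < 1 := lt_of_le_of_ne (ht.le_one μ) (Nat.find_min hex (by omega))
    refine ⟨μ, by rwa [hspec], ?_, ?_⟩
    · intro i
      rw [coxDeBoor]
      refine if_congr ⟨?_, ?_⟩ rfl rfl
      · rintro (⟨-, h4⟩ | ⟨h3, h4, -⟩)
        · exact absurd h4 (not_lt.2 (ht.le_one _))
        · by_contra hne
          rcases lt_or_gt_of_ne hne with h | h
          · have := ht.mono (show i + 1 ≤ μ by omega)
            linarith
          · have := ht.mono (show μ + 1 ≤ i by omega)
            linarith
      · rintro rfl
        exact Or.inr ⟨by rwa [hspec], hspec, rfl⟩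
    · have : side 1 = Iio 1 := by simp [side]
      rw [this]
      filter_upwards [Ioo_mem_nhdsLT hlt] with z hz
      exact cell_of_mem ht.mono hz.1.le (by rw [hspec]; exact hz.2) hz.2.ne
  · have hxlt : x < 1 := lt_of_le_of_ne hx.2 hx1
    have hex : ∃ n, x < t n := ⟨M, by rwa [hM]⟩
    obtain ⟨μ, hμ⟩ : ∃ μ, Nat.find hex = μ + 1 :=
      Nat.exists_eq_succ_of_ne_zero fun h => by
        have := h ▸ Nat.find_spec hex
        rw [h00] at this
        exact absurd this (not_lt.2 hx.1)
    have hspec : x < t (μ + 1) := hμ ▸ Nat.find_spec hex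
    have hle : t μ ≤ x := not_lt.1 (Nat.find_min hex (by omega))
    refine ⟨μ, hle.trans_lt hspec, cell_of_mem ht.mono hle hspec hx1, ?_⟩
    rw [side, if_neg hx1]
    filter_upwards [Ioo_mem_nhdsGT hspec] with z hz
    exact cell_of_mem ht.mono (hle.trans hz.1.le) hz.2 (hz.2.trans_le (ht.le_one _)).ne

theorem IsKnots.d01_eq_zero {dg : ℕ} {t : ℕ → ℝ} (ht : IsKnots dg t) {x : ℝ} (hx : x ∈ I01)
    {μ d i : ℕ} (hc : Cell t μ x) (hi : ¬ (i ≤ μ ∧ μ ≤ i + d)) :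
    d01 (coxDeBoor t d i) x = 0 := by
  obtain ⟨ν, -, -, h1, h2⟩ := ht.exists_cell hx
  obtain rfl := hc.unique h1
  exact TwoPatch.d01_eq_zero hx (hc.eq_zero d i hi) (h2.mono fun z hz => hz.eq_zero d i hi)

theorem isKnots_openKnots {dg m k : ℕ} {τ : ℕ → ℝ} (hm : 0 < m) (hpos : ∀ i < k, 0 < τ i)
    (hlt : ∀ i < k, τ i < 1) (hmono : ∀ i, i + 1 < k → τ i < τ (i + 1)) :
    IsKnots dg (openKnots dg m k τ) := by
  have hidx : ∀ j, ¬ dg + k * m < j → ¬ j ≤ dg → (j - (dg + 1)) / m < k := fun j h1 h2 =>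
    (Nat.div_lt_iff_lt_mul hm).2 (by omega)
  have hmono' : ∀ a b, a ≤ b → b < k → τ a ≤ τ b := by
    intro a b hab
    induction b, hab using Nat.le_induction with
    | base => exact fun _ => le_rfl
    | succ b _ ih => exact fun hb => (ih (by omega)).trans (hmono b hb).le
  have hle : ∀ j, openKnots dg m k τ j ≤ 1 := fun j => by
    unfold openKnots
    split_ifs with h1 h2
    · exact zero_le_one
    · exact le_rfl
    · exact (hlt _ (hidx j h2 h1)).le
  refine ⟨fun a b hab => ?_, fun j hj => if_pos hj, hle, dg + k * m + 1, ?_⟩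
  · by_cases hb : dg + k * m < b
    · have : openKnots dg m k τ b = 1 := by
        rw [openKnots, if_neg (by omega), if_pos hb]
      rw [this]
      exact hle a
    · by_cases ha : a ≤ dg
      · rw [openKnots, if_pos ha, openKnots]
        split_ifs with h1
        · exact le_rfl
        · exact (hpos _ (hidx b hb h1)).le
      · rw [openKnots, openKnots, if_neg ha, if_neg (by omega), if_neg (by omega), if_neg hb]
        exact hmono' _ _ (Nat.div_le_div_right (by omega)) (hidx b hb (by omega))
  · rw [openKnots, if_neg (by omega), if_pos (by omega)]

theorem openKnots_succ_eq {dg m k : ℕ} {τ : ℕ → ℝ} (hm : 2 ≤ m) :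
    openKnots dg m k τ (dg + 2) = openKnots dg m k τ (dg + 1) := by
  rcases Nat.eq_zero_or_pos k with rfl | hk
  · simp [openKnots]
  · have : m ≤ k * m := Nat.le_mul_of_pos_left m hk
    rw [openKnots, openKnots, if_neg (by omega), if_neg (by omega), if_neg (by omega),
      if_neg (by omega)]
    congr 1
    rw [Nat.div_eq_of_lt (by omega), Nat.div_eq_of_lt (by omega)]

/-- Pullback of the basis functions to the left patch, for gluing data `α`, `β`. -/
def pull (p r k : ℕ) (τ : ℕ → ℝ) (α β : ℝ → ℝ) : PhiIdx → ℝ × ℝ → ℝ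
  | .inL i j => fOmega p r k τ i j
  | .inR _ _ => fun _ => 0
  | .g0 i => fGamma0 p r k τ β i
  | .g1 i => fGamma1 p r k τ α i

/-- Exchange of the two patches. -/
def PhiIdx.swap : PhiIdx → PhiIdx
  | .inL i j => .inR i j
  | .inR i j => .inL i j
  | .g0 i => .g0 i
  | .g1 i => .g1 i

theorem PhiIdx.swap_swap (e : PhiIdx) : e.swap.swap = e := by cases e <;> rfl

theorem PhiIdx.valid_swap {p r k : ℕ} {e : PhiIdx} (h : e.valid p r k) : e.swap.valid p r k := by
  cases e <;> exact h

/-- Tensor-product point functionals applied to a vanishing linear combination. -/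
theorem sum_mul_tensor_eq_zero {ι α β : Type*} [Fintype α] [Fintype β] {s : Finset ι}
    {g : ι → ℝ} {f : ι → ℝ × ℝ → ℝ} {A B : Set ℝ}
    (h : ∀ a ∈ A, ∀ b ∈ B, ∑ e ∈ s, g e * f e (a, b) = 0) {x v : α → ℝ} {y w : β → ℝ}
    (hx : ∀ a, x a ∈ A) (hy : ∀ b, y b ∈ B) :
    ∑ e ∈ s, g e * ∑ b, w b * ∑ a, v a * f e (x a, y b) = 0 := by
  calc ∑ e ∈ s, g e * ∑ b, w b * ∑ a, v a * f e (x a, y b)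
      = ∑ b, w b * ∑ a, v a * ∑ e ∈ s, g e * f e (x a, y b) := by
        simp only [Finset.mul_sum]
        rw [Finset.sum_comm]
        refine Finset.sum_congr rfl fun b _ => ?_
        rw [Finset.sum_comm]
        refine Finset.sum_congr rfl fun a _ => Finset.sum_congr rfl fun e _ => ?_
        ring
    _ = 0 := by simp [h _ (hx _) _ (hy _)]

section DualFunctional

variable {p r k : ℕ} {τ : ℕ → ℝ} {ι : Type*} [Fintype ι] {v x : ι → ℝ} {i₀ : ℕ}

theorem sum_mul_fOmega
    (hv : ∀ i, ∑ a, v a * Bspl p (p - r) k τ i (x a) = if i = i₀ then 1 else 0) (i j : ℕ) (y : ℝ) :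
    ∑ a, v a * fOmega p r k τ i j (x a, y) =
      (if i = i₀ then 1 else 0) * Bspl p (p - r) k τ j y := by
  rw [← hv, Finset.sum_mul]
  exact Finset.sum_congr rfl fun a _ => by rw [fOmega]; ring

theorem sum_mul_fGamma0
    (hv : ∀ i, ∑ a, v a * Bspl p (p - r) k τ i (x a) = if i = i₀ then 1 else 0)
    (β : ℝ → ℝ) (i : ℕ) (y : ℝ) :
    ∑ a, v a * fGamma0 p r k τ β i (x a, y) =
      (if 0 = i₀ then 1 else 0) * Bspl p (p - r - 1) k τ i y +
      (if 1 = i₀ then 1 else 0) * (Bspl p (p - r - 1) k τ i y +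
        β y * d01 (Bspl p (p - r - 1) k τ i) y * (τ 0 / (p : ℝ))) := by
  rw [← hv, ← hv, Finset.sum_mul, Finset.sum_mul, ← Finset.sum_add_distrib]
  exact Finset.sum_congr rfl fun a _ => by rw [fGamma0]; ring

theorem sum_mul_fGamma1
    (hv : ∀ i, ∑ a, v a * Bspl p (p - r) k τ i (x a) = if i = i₀ then 1 else 0)
    (α : ℝ → ℝ) (i : ℕ) (y : ℝ) :
    ∑ a, v a * fGamma1 p r k τ α i (x a, y) =
      (if 1 = i₀ then 1 else 0) * (α y * Bspl (p - 1) (p - r - 1) k τ i y) := by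
  rw [← hv, Finset.sum_mul]
  exact Finset.sum_congr rfl fun a _ => by rw [fGamma1]; ring

end DualFunctional

/-- If a linear combination of pulled back basis functions vanishes near a point of the parametric
square, then the coefficients of the functions that do not vanish at this point are zero. -/
theorem coeff_eq_zero_of_pull_ne_zero {p r k : ℕ} {τ : ℕ → ℝ} (hp : 3 ≤ p) (hrp : r ≤ p - 2)
    (hpos : ∀ i < k, 0 < τ i) (hlt : ∀ i < k, τ i < 1) (hmono : ∀ i, i + 1 < k → τ i < τ (i + 1))
    {α β : ℝ → ℝ} (hα : ∀ x ∈ I01, α x ≠ 0) {ι : Type*} {s : Finset ι} {idx : ι → PhiIdx}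
    (hinj : Function.Injective idx) (hvalid : ∀ e, (idx e).valid p r k) {g : ι → ℝ}
    {q₀ : ℝ × ℝ} (hq₀ : q₀ ∈ sq)
    (hsum : ∀ᶠ q in 𝓝[sq] q₀, ∑ e ∈ s, g e * pull p r k τ α β (idx e) q = 0)
    {e₀ : ι} (he₀ : e₀ ∈ s) (hne : pull p r k τ α β (idx e₀) q₀ ≠ 0) : g e₀ = 0 := by
  obtain ⟨ξ, η⟩ := q₀
  have hsq : sq = I01 ×ˢ I01 := (Icc_prod_Icc 0 1 0 1).symm
  rw [hsq] at hq₀ hsum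
  obtain ⟨hξ, hη⟩ : ξ ∈ I01 ∧ η ∈ I01 := hq₀
  rw [nhdsWithin_prod_eq] at hsum
  obtain ⟨A₀, hA₀, B₀, hB₀, hAB⟩ := Filter.mem_prod_iff.1 hsum
  have hside : ∀ {z : ℝ}, z ∈ I01 → 𝓝[side z] z ≤ 𝓝[I01] z := fun hz =>
    nhdsWithin_le_iff.2 (I01_mem_side hz)
  have K1 : IsKnots p (openKnots p (p - r) k τ) := isKnots_openKnots (by omega) hpos hlt hmono
  have K2 : IsKnots p (openKnots p (p - r - 1) k τ) :=
    isKnots_openKnots (by omega) hpos hlt hmono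
  have K3 : IsKnots (p - 1) (openKnots (p - 1) (p - r - 1) k τ) :=
    isKnots_openKnots (by omega) hpos hlt hmono
  obtain ⟨μ, hμ, hpμ, cμ, cμ'⟩ := K1.exists_cell hξ
  obtain ⟨ν₁, hν₁, hpν₁, cν₁, cν₁'⟩ := K1.exists_cell hη
  obtain ⟨ν₂, hν₂, hpν₂, cν₂, cν₂'⟩ := K2.exists_cell hη
  obtain ⟨ν₃, hν₃, hpν₃, cν₃, cν₃'⟩ := K3.exists_cell hη
  let A : Set ℝ := {x | x ∈ A₀ ∧ Cell (openKnots p (p - r) k τ) μ x}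
  let B : Set ℝ := {y | y ∈ B₀ ∧ y ∈ I01 ∧ Cell (openKnots p (p - r) k τ) ν₁ y ∧
    Cell (openKnots p (p - r - 1) k τ) ν₂ y ∧ Cell (openKnots (p - 1) (p - r - 1) k τ) ν₃ y}
  have hA : A.Infinite := infinite_of_mem_side (inter_mem (hside hξ hA₀) cμ')
  have hB : B.Infinite := infinite_of_mem_side
    (inter_mem (hside hη hB₀) (inter_mem (I01_mem_side hη) (inter_mem cν₁' (inter_mem cν₂' cν₃'))))
  have hzero : ∀ x ∈ A, ∀ y ∈ B, ∑ e ∈ s, g e * pull p r k τ α β (idx e) (x, y) = 0 :=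
    fun x hx y hy => hAB (mk_mem_prod hx.1 hy.1)
  have hidx : ∀ {e e' : ι} {f : PhiIdx}, idx e' = f → e ≠ e' → idx e ≠ f := fun h hee' h' =>
    hee' (hinj (h'.trans h.symm))
  have hcorner : Bspl p (p - r) k τ 0 ξ ≠ 0 ∨ Bspl p (p - r) k τ 1 ξ ≠ 0 → μ = p := by
    intro h
    have hle : μ ≤ p + 1 := by
      rcases h with h | h
      · have := not_not.1 (mt (cμ.eq_zero p 0) h)
        omega
      · have := not_not.1 (mt (cμ.eq_zero p 1) h)
        omega
    by_contra hne
    obtain rfl : μ = p + 1 := by omega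
    rw [openKnots_succ_eq (by omega)] at hμ
    exact lt_irrefl _ hμ
  -- the coefficients of the active functions that carry the trace on the interface vanish
  have hg0 : ∀ e ∈ s, ∀ i, idx e = .g0 i → μ = p → (i ≤ ν₂ ∧ ν₂ ≤ i + p) → g e = 0 := by
    intro e₁ he₁ i₁ hi₁ hμp hact
    obtain ⟨x, v, hx, hv⟩ := exists_dual K1.mono hμ hpμ hA (fun x hx => hx.2)
      (i₀ := 0) (by omega)
    obtain ⟨y, w, hy, hw⟩ := exists_dual K2.mono hν₂ hpν₂ hB (fun x hx => hx.2.2.2.1) hact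
    change ∀ i, ∑ a, v a * Bspl p (p - r) k τ i (x a) = _ at hv
    change ∀ i, ∑ b, w b * Bspl p (p - r - 1) k τ i (y b) = _ at hw
    have h := sum_mul_tensor_eq_zero hzero (v := v) (w := w) hx hy
    rw [Finset.sum_eq_single e₁ ?_ (absurd he₁)] at h
    · simpa [hi₁, pull, sum_mul_fGamma0 hv, hw] using h
    · intro e _ hee
      have hv' := hvalid e
      have hd := hidx hi₁ hee
      cases he : idx e with
      | inR i j => simp [pull]
      | inL i j =>
        rw [he] at hv'
        have : i ≠ 0 := by have := hv'.1; omega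
        simp [pull, sum_mul_fOmega hv, this]
      | g0 i =>
        have : i ≠ i₁ := fun h => hd (h ▸ he)
        simp [pull, sum_mul_fGamma0 hv, hw, this]
      | g1 i => simp [pull, sum_mul_fGamma1 hv]
  cases hi : idx e₀ with
  | inR i j => simp [hi, pull] at hne
  | inL i₁ j₁ =>
    rw [hi] at hne
    have hi₁ : 2 ≤ i₁ := by
      have := hvalid e₀
      rw [hi] at this
      exact this.1
    obtain ⟨x, v, hx, hv⟩ := exists_dual K1.mono hμ hpμ hA (fun x hx => hx.2)
      (not_not.1 (mt (cμ.eq_zero p i₁) (left_ne_zero_of_mul hne)))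
    obtain ⟨y, w, hy, hw⟩ := exists_dual K1.mono hν₁ hpν₁ hB (fun x hx => hx.2.2.1)
      (not_not.1 (mt (cν₁.eq_zero p j₁) (right_ne_zero_of_mul hne)))
    change ∀ i, ∑ a, v a * Bspl p (p - r) k τ i (x a) = _ at hv
    change ∀ i, ∑ b, w b * Bspl p (p - r) k τ i (y b) = _ at hw
    have h := sum_mul_tensor_eq_zero hzero (v := v) (w := w) hx hy
    have h0 : 0 ≠ i₁ := by omega
    have h1 : 1 ≠ i₁ := by omega
    rw [Finset.sum_eq_single e₀ ?_ (absurd he₀)] at h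
    · simpa [hi, pull, sum_mul_fOmega hv, hw] using h
    · intro e _ hee
      have hd := hidx hi hee
      cases he : idx e with
      | inR i j => simp [pull]
      | inL i j =>
        by_cases hii : i = i₁
        · have : j ≠ j₁ := fun h => hd (by rw [he, h, hii])
          simp [pull, sum_mul_fOmega hv, hii, hw, this]
        · simp [pull, sum_mul_fOmega hv, hii]
      | g0 i => simp [pull, sum_mul_fGamma0 hv, h0, h1]
      | g1 i => simp [pull, sum_mul_fGamma1 hv, h1]
  | g0 i =>
    rw [hi] at hne
    refine hg0 e₀ he₀ i hi (hcorner ?_) ?_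
    · by_contra! h0
      simp [pull, fGamma0, h0.1, h0.2] at hne
    · by_contra h0
      have h1 : Bspl p (p - r - 1) k τ i η = 0 := cν₂.eq_zero p i h0
      have h2 : d01 (Bspl p (p - r - 1) k τ i) η = 0 := K2.d01_eq_zero hη cν₂ h0
      simp [pull, fGamma0, h1, h2] at hne
  | g1 i₁ =>
    rw [hi] at hne
    have hμp := hcorner (Or.inr (right_ne_zero_of_mul hne))
    obtain ⟨x, v, hx, hv⟩ := exists_dual K1.mono hμ hpμ hA (fun x hx => hx.2)
      (i₀ := 1) (by omega)
    obtain ⟨y, w, hy, hw⟩ := exists_dual K3.mono hν₃ hpν₃ hB (fun x hx => hx.2.2.2.2)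
      (not_not.1 (mt (cν₃.eq_zero (p - 1) i₁)
        (right_ne_zero_of_mul (left_ne_zero_of_mul hne))))
    change ∀ i, ∑ a, v a * Bspl p (p - r) k τ i (x a) = _ at hv
    change ∀ i, ∑ b, w b * Bspl (p - 1) (p - r - 1) k τ i (y b) = _ at hw
    have h := sum_mul_tensor_eq_zero hzero (v := v) (w := fun b => w b / α (y b)) hx hy
    have hα' : ∀ i, ∑ b, w b / α (y b) * (α (y b) * Bspl (p - 1) (p - r - 1) k τ i (y b))
        = if i = i₁ then 1 else 0 := fun i => by
      rw [← hw]
      refine Finset.sum_congr rfl fun b _ => ?_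
      rw [← mul_assoc, div_mul_cancel₀ _ (hα _ (hy b).2.1)]
    rw [Finset.sum_eq_single e₀ ?_ (absurd he₀)] at h
    · simpa [hi, pull, sum_mul_fGamma1 hv, hα'] using h
    · intro e hes hee
      have hv' := hvalid e
      have hd := hidx hi hee
      cases he : idx e with
      | inR i j => simp [pull]
      | inL i j =>
        rw [he] at hv'
        have : i ≠ 1 := by have := hv'.1; omega
        simp [pull, sum_mul_fOmega hv, this]
      | g0 i =>
        by_cases hact : i ≤ ν₂ ∧ ν₂ ≤ i + p
        · rw [hg0 e hes i he hμp hact, zero_mul]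
        · have h1 : ∀ b, Bspl p (p - r - 1) k τ i (y b) = 0 := fun b =>
            (hy b).2.2.2.1.eq_zero p i hact
          have h2 : ∀ b, d01 (Bspl p (p - r - 1) k τ i) (y b) = 0 := fun b =>
            K2.d01_eq_zero (hy b).2.1 (hy b).2.2.2.1 hact
          simp [pull, sum_mul_fGamma0 hv, h1, h2]
      | g1 i =>
        have : i ≠ i₁ := fun h => hd (h ▸ he)
        simp [pull, sum_mul_fGamma1 hv, hα', this]

namespace ASG1

variable (G : ASG1)

theorem glue_FL (fL fR : ℝ × ℝ → ℝ) {q : ℝ × ℝ} (hq : q ∈ sq) : G.glue fL fR (G.FL q) = fL q := by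
  have hmem : G.FL q ∈ G.ΩL := mem_image_of_mem _ hq
  rw [glue, if_pos hmem, G.hFLinj.leftInvOn_invFunOn hq]

theorem FR_notMem_ΩL {q : ℝ × ℝ} (hq : q ∈ sq) (h0 : q.1 ≠ 0) : G.FR q ∉ G.ΩL := by
  intro hmem
  obtain ⟨ξ, hξ, h⟩ : G.FR q ∈ (fun ξ : ℝ => G.FL (0, ξ)) '' I01 :=
    G.hGamma ▸ ⟨hmem, mem_image_of_mem _ hq⟩
  have hq' : ((0 : ℝ), ξ) ∈ sq := ⟨⟨le_rfl, hξ.1⟩, ⟨zero_le_one, hξ.2⟩⟩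
  have := G.hFRinj hq' hq ((G.hIface ξ hξ).symm.trans h)
  exact h0 (this ▸ rfl)

theorem glue_FR (fL fR : ℝ × ℝ → ℝ) {q : ℝ × ℝ} (hq : q ∈ sq) (h0 : q.1 ≠ 0) :
    G.glue fL fR (G.FR q) = fR q := by
  have hmem : G.FR q ∈ G.ΩR := mem_image_of_mem _ hq
  rw [glue, if_neg (G.FR_notMem_ΩL hq h0), if_pos hmem, G.hFRinj.leftInvOn_invFunOn hq]

theorem phiLvl_zero_FL (e : PhiIdx) {q : ℝ × ℝ} (hq : q ∈ sq) :
    G.phiLvl 0 e (G.FL q) = pull G.p G.r G.k G.τ G.αL G.βL e q := by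
  cases e <;> simp only [phiLvl, phiAt, pull, levelK, levelτ, G.glue_FL _ _ hq]

theorem phiLvl_zero_FR (e : PhiIdx) {q : ℝ × ℝ} (hq : q ∈ sq) (h0 : q.1 ≠ 0) :
    G.phiLvl 0 e (G.FR q) = pull G.p G.r G.k G.τ G.αR G.βR e.swap q := by
  cases e <;>
    simp only [phiLvl, phiAt, pull, PhiIdx.swap, levelK, levelτ, G.glue_FR _ _ hq h0]

theorem coeff_eq_zero_of_phiLvl_ne_zero {O : Set (ℝ × ℝ)} (hO : IsOpen O) {ι : Type*}
    {s : Finset ι} {idx : ι → PhiIdx} (hinj : Function.Injective idx)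
    (hvalid : ∀ e, (idx e).valid G.p G.r G.k) {g : ι → ℝ}
    (hsum : ∀ x ∈ O ∩ G.dom, ∑ e ∈ s, g e * G.phiLvl 0 (idx e) x = 0)
    {e₀ : ι} (he₀ : e₀ ∈ s) {x₀ : ℝ × ℝ} (hx₀ : x₀ ∈ O ∩ G.dom)
    (hne : G.phiLvl 0 (idx e₀) x₀ ≠ 0) : g e₀ = 0 := by
  by_cases hL : x₀ ∈ G.ΩL
  · obtain ⟨q₀, hq₀, rfl⟩ := hL
    rw [G.phiLvl_zero_FL _ hq₀] at hne
    refine coeff_eq_zero_of_pull_ne_zero G.hp G.hrp G.hτpos G.hτlt G.hτmono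
      (fun x hx => left_ne_zero_of_mul (G.hαneg x hx).ne) hinj hvalid hq₀ ?_ he₀ hne
    filter_upwards [G.hFLc1.continuousOn q₀ hq₀ (hO.mem_nhds hx₀.1), self_mem_nhdsWithin]
      with q hqO hq
    rw [← hsum (G.FL q) ⟨hqO, Or.inl (mem_image_of_mem _ hq)⟩]
    simp only [G.phiLvl_zero_FL _ hq]
  · obtain ⟨q₀, hq₀, rfl⟩ : x₀ ∈ G.ΩR := hx₀.2.resolve_left hL
    have h0 : q₀.1 ≠ 0 := by
      intro h0
      refine hL ⟨q₀, hq₀, ?_⟩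
      have : q₀ = (0, q₀.2) := Prod.ext h0 rfl
      rw [this]
      exact G.hIface _ ⟨hq₀.1.2, hq₀.2.2⟩
    rw [G.phiLvl_zero_FR _ hq₀ h0] at hne
    have hinj' : Function.Injective fun e => (idx e).swap := fun a b hab => hinj <| by
      rw [← (idx a).swap_swap, ← (idx b).swap_swap]
      exact congrArg PhiIdx.swap hab
    refine coeff_eq_zero_of_pull_ne_zero G.hp G.hrp G.hτpos G.hτlt G.hτmono
      (fun x hx => right_ne_zero_of_mul (G.hαneg x hx).ne) hinj'
      (fun e => PhiIdx.valid_swap (hvalid e)) hq₀ ?_ he₀ hne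
    filter_upwards [G.hFRc1.continuousOn q₀ hq₀ (hO.mem_nhds hx₀.1), self_mem_nhdsWithin,
      mem_nhdsWithin_of_mem_nhds (continuous_fst.continuousAt.eventually_ne h0)] with q hqO hq hq0
    rw [← hsum (G.FR q) ⟨hqO, Or.inr (mem_image_of_mem _ hq)⟩]
    simp only [G.phiLvl_zero_FR _ hq hq0]

end ASG1

/-- The basis `Φ` is locally linearly independent on the
two-patch domain `Ω`:  for every open `O ⊆ ℝ²` with `O ∩ Ω ≠ ∅`, the functions
of `Φ` not vanishing identically on `O ∩ Ω` are linearly independent as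
functions on `O ∩ Ω`. -/
theorem phi_locally_linearly_independent (G : ASG1) (O : Set (ℝ × ℝ))
    (hO : IsOpen O) (hne : (O ∩ G.dom).Nonempty) :
    LinearIndependent ℝ
      (fun f : {f : ℝ × ℝ → ℝ // f ∈ G.PhiSet ∧ ¬ ∀ x ∈ O ∩ G.dom, f x = 0} =>
        (O ∩ G.dom).restrict f.1) := by
  choose idx hvalid hidx using fun
    f : {f : ℝ × ℝ → ℝ // f ∈ G.PhiSet ∧ ¬ ∀ x ∈ O ∩ G.dom, f x = 0} => f.2.1
  have hinj : Function.Injective idx := fun f f' h =>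
    Subtype.ext (by rw [← hidx f, ← hidx f', h])
  refine linearIndependent_iff'.2 fun s g hg f hf => ?_
  obtain ⟨x, hx, hfx⟩ := not_forall₂.1 f.2.2
  refine G.coeff_eq_zero_of_phiLvl_ne_zero hO hinj hvalid (fun z hz => ?_) hf hx
    (by rwa [hidx f])
  have := congrFun hg ⟨z, hz⟩
  rw [Finset.sum_apply] at this
  simp only [hidx]
  exact this

end TwoPatch
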